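/- Let (A, σ_A) and (B, σ_B) be commutative rings with ring involutions, and let f : A → B be an equivariant ring homomorphism (f ∘ σ_A = σ_B ∘ f). Then the canonical ring homomorphism μ : B^{σ_B} ⊗_{A^{σ_A}} A → B, b ⊗ a ↦ b·f(a), is bijective if and only if the B^{σ_B}-linear map λ_f : B^{σ_B} ⊗_{A^{σ_A}} L_A → L_B, b ⊗ x ↦ b·f(x), is bijective. -/

import Mathlib

/-- The fixed subring `A^σ` of a ring involution `σ`. -/
def fixedSubring {A : Type*} [CommRing A] (σ : A →+* A) : Subring A where
  carrier := {a | σ a = a}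
  mul_mem' := fun {a b} ha hb => by
    simp only [Set.mem_setOf_eq] at *; rw [map_mul, ha, hb]
  one_mem' := by simp only [Set.mem_setOf_eq, map_one]
  add_mem' := fun {a b} ha hb => by
    simp only [Set.mem_setOf_eq] at *; rw [map_add, ha, hb]
  zero_mem' := by simp only [Set.mem_setOf_eq, map_zero]
  neg_mem' := fun {a} ha => by
    simp only [Set.mem_setOf_eq] at *; rw [map_neg, ha]

/-- `L_A = {a - σ a : a ∈ A}` as an `A^σ`-submodule of `A`. -/
def lsub {A : Type*} [CommRing A] (σ : A →+* A) : Submodule (fixedSubring σ) A where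
  carrier := Set.range fun a => a - σ a
  add_mem' := by
    rintro _ _ ⟨a, rfl⟩ ⟨b, rfl⟩
    exact ⟨a + b, by simp only []; rw [map_add]; ring⟩
  zero_mem' := ⟨0, by simp⟩
  smul_mem' := by
    rintro ⟨c, hc⟩ _ ⟨a, rfl⟩
    refine ⟨c * a, ?_⟩
    have hc' : σ c = c := hc
    show c * a - σ (c * a) = c • (a - σ a)
    rw [map_mul, hc']
    show c * a - c * σ a = c * (a - σ a)
    ring

section Equivariant

variable {A B : Type*} [CommRing A] [CommRing B]

/-- An equivariant ring homomorphism restricts to a homomorphism of fixed subrings. -/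
def fixedHom (σA : A →+* A) (σB : B →+* B) (f : A →+* B)
    (hf : ∀ a : A, f (σA a) = σB (f a)) : fixedSubring σA →+* fixedSubring σB where
  toFun a := ⟨f a, by
    have h : σA (a : A) = a := a.2
    show σB (f a) = f a
    rw [← hf, h]⟩
  map_one' := Subtype.ext (by simp)
  map_mul' x y := Subtype.ext (by simp)
  map_zero' := Subtype.ext (by simp)
  map_add' x y := Subtype.ext (by simp)

/-- The additive bilinear pairing `(b, a) ↦ b * f a` underlying the map `μ`. -/
def muBil (σB : B →+* B) (f : A →+* B) : fixedSubring σB →+ A →+ B where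
  toFun b := (AddMonoidHom.mulLeft (b : B)).comp f.toAddMonoidHom
  map_zero' := by ext a; simp
  map_add' b c := by ext a; simp [add_mul]

/-- The canonical map `μ : B^{σ_B} ⊗_{A^{σ_A}} A → B`, `b ⊗ a ↦ b * f a`, where
`B^{σ_B}` is an `A^{σ_A}`-module via the restriction of `f` to the fixed subrings. -/
noncomputable def muMap (σA : A →+* A) (σB : B →+* B) (f : A →+* B)
    (hf : ∀ a : A, f (σA a) = σB (f a)) :
    (@TensorProduct (fixedSubring σA) _ (fixedSubring σB) A _ _
      (Module.compHom (fixedSubring σB) (fixedHom σA σB f hf)) _) →+ B :=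
  letI : Module (fixedSubring σA) (fixedSubring σB) :=
    Module.compHom (fixedSubring σB) (fixedHom σA σB f hf)
  TensorProduct.liftAddHom (muBil σB f) (by
    rintro r b a
    show ((fixedHom σA σB f hf r * b : fixedSubring σB) : B) * f a = (b : B) * f ((r : A) * a)
    show (f (r : A) * (b : B)) * f a = (b : B) * f ((r : A) * a)
    rw [map_mul]
    ring)

/-- The additive bilinear pairing `(b, x) ↦ b * f x` underlying the map `λ_f`,
with values in `L_B`. -/
def lamBil (σA : A →+* A) (σB : B →+* B) (f : A →+* B)
    (hf : ∀ a : A, f (σA a) = σB (f a)) : fixedSubring σB →+ lsub σA →+ lsub σB where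
  toFun b :=
    { toFun := fun x => ⟨(b : B) * f (x : A), by
        obtain ⟨a, ha⟩ := x.2
        have hb : σB (b : B) = (b : B) := b.2
        refine ⟨(b : B) * f a, ?_⟩
        simp only []
        rw [← ha, map_sub, hf, map_mul, hb]
        ring⟩
      map_zero' := Subtype.ext (by simp)
      map_add' := fun x y => Subtype.ext (by
        show (b : B) * f ((x : A) + (y : A)) = (b : B) * f (x : A) + (b : B) * f (y : A)
        rw [map_add, mul_add]) }
  map_zero' := by
    ext x
    show ((0 : fixedSubring σB) : B) * f (x : A) = ((0 : lsub σB) : B)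
    simp
  map_add' b c := by
    ext x
    show ((b + c : fixedSubring σB) : B) * f (x : A) = _
    simp only [Subring.coe_add, add_mul]
    rfl

/-- The canonical map `λ_f : B^{σ_B} ⊗_{A^{σ_A}} L_A → L_B`, `b ⊗ x ↦ b * f x`. -/
noncomputable def lamMap (σA : A →+* A) (σB : B →+* B) (f : A →+* B)
    (hf : ∀ a : A, f (σA a) = σB (f a)) :
    (@TensorProduct (fixedSubring σA) _ (fixedSubring σB) (lsub σA) _ _
      (Module.compHom (fixedSubring σB) (fixedHom σA σB f hf)) _) →+ lsub σB :=
  letI : Module (fixedSubring σA) (fixedSubring σB) :=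
    Module.compHom (fixedSubring σB) (fixedHom σA σB f hf)
  TensorProduct.liftAddHom (lamBil σA σB f hf) (by
    rintro r b x
    apply Subtype.ext
    show (f (r : A) * (b : B)) * f (x : A) = (b : B) * f ((r : A) * (x : A))
    rw [map_mul]
    ring)

end Equivariant

/-- The surjection `a ↦ a - σ a` from `A` onto `L_A`, linear over the fixed subring. -/
def dLin {A : Type*} [CommRing A] (σ : A →+* A) : A →ₗ[fixedSubring σ] lsub σ where
  toFun a := ⟨a - σ a, a, rfl⟩
  map_add' a b := Subtype.ext (by
    show a + b - σ (a + b) = (a - σ a) + (b - σ b)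
    rw [map_add]; ring)
  map_smul' c a := Subtype.ext (by
    have hc : σ (c : A) = c := c.2
    show (c : A) * a - σ ((c : A) * a) = (c : A) * (a - σ a)
    rw [map_mul, hc]; ring)

theorem dLin_surjective {A : Type*} [CommRing A] (σ : A →+* A) :
    Function.Surjective (dLin σ) := by
  rintro ⟨_, a, rfl⟩
  exact ⟨a, rfl⟩

theorem dLin_eq_zero {A : Type*} [CommRing A] (σ : A →+* A) (a : A) :
    dLin σ a = 0 ↔ σ a = a := by
  rw [Subtype.ext_iff]
  show a - σ a = 0 ↔ _
  rw [sub_eq_zero, eq_comm]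

theorem dLin_exact {A : Type*} [CommRing A] (σ : A →+* A) :
    Function.Exact (Algebra.linearMap (fixedSubring σ) A) (dLin σ) := by
  intro a
  rw [dLin_eq_zero]
  constructor
  · intro h; exact ⟨⟨a, h⟩, rfl⟩
  · rintro ⟨r, rfl⟩; exact r.2

open TensorProduct in
/-- For an equivariant ring homomorphism `f : (A, σ_A) → (B, σ_B)`, the canonical map
`μ : B^{σ_B} ⊗_{A^{σ_A}} A → B` is bijective if and only if the canonical map
`λ_f : B^{σ_B} ⊗_{A^{σ_A}} L_A → L_B` is bijective. -/
theorem muMap_bijective_iff_lamMap_bijective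
    {A B : Type*} [CommRing A] [CommRing B]
    (σA : A →+* A) (hσA : ∀ a : A, σA (σA a) = a)
    (σB : B →+* B) (hσB : ∀ b : B, σB (σB b) = b)
    (f : A →+* B) (hf : ∀ a : A, f (σA a) = σB (f a)) :
    Function.Bijective (muMap σA σB f hf) ↔ Function.Bijective (lamMap σA σB f hf) := by
  letI : Module (fixedSubring σA) (fixedSubring σB) :=
    Module.compHom (fixedSubring σB) (fixedHom σA σB f hf)
  set M := muMap σA σB f hf with hM
  set N := lamMap σA σB f hf with hN
  let d := LinearMap.lTensor (fixedSubring σB) (dLin σA)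
  have hd : Function.Surjective d :=
    LinearMap.lTensor_surjective _ (dLin_surjective σA)
  have hMadd : ∀ x y, M (x + y) = M x + M y := M.map_add'
  have hNadd : ∀ x y, N (x + y) = N x + N y := N.map_add'
  have hmu1 : ∀ s : fixedSubring σB, M (s ⊗ₜ[fixedSubring σA] (1 : A)) = s := by
    intro s
    show (s : B) * f 1 = s
    simp
  have hd1 : ∀ s : fixedSubring σB, d (s ⊗ₜ[fixedSubring σA] (1 : A)) = 0 := by
    intro s
    show s ⊗ₜ[fixedSubring σA] (dLin σA 1) = 0
    rw [(dLin_eq_zero σA 1).2 (map_one _), TensorProduct.tmul_zero]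
  have hker : ∀ x, d x = 0 → ∃ s : fixedSubring σB, x = s ⊗ₜ[fixedSubring σA] (1 : A) := by
    intro x hx
    obtain ⟨y, rfl⟩ := ((lTensor_exact (fixedSubring σB) (dLin_exact σA)
      (dLin_surjective σA)) x).1 hx
    obtain ⟨s, rfl⟩ := (TensorProduct.rid (fixedSubring σA) (fixedSubring σB)).symm.surjective y
    exact ⟨s, by simp⟩
  have hcomm : ∀ x, N (d x) = dLin σB (M x) := by
    intro x
    induction x using TensorProduct.induction_on with
    | zero => simp
    | add x y hx hy => rw [map_add, hNadd, hMadd, map_add, hx, hy]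
    | tmul b a =>
      apply Subtype.ext
      have hb : σB (b : B) = b := b.2
      show (b : B) * f (a - σA a) = (b : B) * f a - σB ((b : B) * f a)
      rw [map_sub, map_mul, hb, hf, mul_sub]
  constructor
  · rintro ⟨hi, hs⟩
    constructor
    · rw [injective_iff_map_eq_zero]
      intro y hy
      obtain ⟨x, rfl⟩ := hd y
      rw [hcomm, dLin_eq_zero] at hy
      have : x = (⟨M x, hy⟩ : fixedSubring σB) ⊗ₜ[fixedSubring σA] (1 : A) := hi (hmu1 ⟨M x, hy⟩).symm
      rw [this, hd1]
    · intro z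
      obtain ⟨b, rfl⟩ := dLin_surjective σB z
      obtain ⟨x, rfl⟩ := hs b
      exact ⟨d x, hcomm x⟩
  · rintro ⟨hi, hs⟩
    constructor
    · rw [injective_iff_map_eq_zero]
      intro x hx
      have h0 : d x = 0 := hi (by rw [hcomm, hx, map_zero, map_zero])
      obtain ⟨s, rfl⟩ := hker x h0
      rw [hmu1] at hx
      have : s = 0 := Subtype.ext hx
      rw [this, TensorProduct.zero_tmul]
    · intro b
      obtain ⟨y, hy⟩ := hs (dLin σB b)
      obtain ⟨x, rfl⟩ := hd y
      rw [hcomm] at hy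
      have h := sub_eq_zero.2 hy.symm
      rw [← map_sub, dLin_eq_zero] at h
      refine ⟨x + (⟨b - M x, h⟩ : fixedSubring σB) ⊗ₜ[fixedSubring σA] (1 : A), ?_⟩
      rw [hMadd, hmu1]
      simp
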